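/- arXiv:1105.1732 — 2 statements merged into one kernel-verified Lean document; each statement's English description precedes it below -/
import Mathlib

section
/- Let n ≥ 1 and let A_F = circ(F₀, F₁, …, F_{n-1}) be the n×n circulant matrix whose entries are the first n Fibonacci numbers. Then the spectral norm of A_F satisfies ‖A_F‖₂ = F_{n+1} − 1. -/
/-- The `n × n` circulant matrix whose `(i,j)` entry is `x ((j - i) mod n)`. -/
def circMatrix {n : ℕ} (x : Fin n → ℝ) : Matrix (Fin n) (Fin n) ℝ :=
  Matrix.of fun i j => x (j - i)

open Finset WithLp in
/-- The spectral norm of a circulant matrix with nonnegative entries is its row sum. -/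
theorem norm_toEuclideanCLM_circMatrix_of_nonneg {n : ℕ} [NeZero n] {x : Fin n → ℝ}
    (hx : ∀ i, 0 ≤ x i) :
    ‖Matrix.toEuclideanCLM (𝕜 := ℝ) (circMatrix x)‖ = ∑ i, x i := by
  have hs : 0 ≤ ∑ i, x i := sum_nonneg fun i _ => hx i
  apply le_antisymm
  · refine ContinuousLinearMap.opNorm_le_bound _ hs fun v => ?_
    have shift_sum : Matrix.toEuclideanCLM (𝕜 := ℝ) (circMatrix x) v =
        ∑ k, x k • toLp 2 (fun i => v (k + i)) := by
      ext i
      simp only [Matrix.ofLp_toEuclideanCLM, Matrix.mulVec, dotProduct, circMatrix,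
        Matrix.of_apply, ofLp_sum, ofLp_smul, Finset.sum_apply, Pi.smul_apply, smul_eq_mul]
      rw [← Equiv.sum_comp (Equiv.addRight i)]
      simp
    have norm_shift (k : Fin n) : ‖toLp 2 (fun i => v (k + i))‖ = ‖v‖ := by
      simp only [EuclideanSpace.norm_eq]
      congr 1
      exact Equiv.sum_comp (Equiv.addLeft k) fun i => ‖v i‖ ^ 2
    rw [shift_sum, sum_mul]
    refine norm_sum_le_of_le _ fun k _ => ?_
    rw [norm_smul, norm_shift, Real.norm_of_nonneg (hx k)]
  · have row_sum : Matrix.toEuclideanCLM (𝕜 := ℝ) (circMatrix x) (toLp 2 1) =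
        (∑ i, x i) • toLp 2 (1 : Fin n → ℝ) := by
      ext i
      simpa [Matrix.mulVec, dotProduct, circMatrix] using Equiv.sum_comp (Equiv.subRight i) x
    have ones_pos : 0 < ‖toLp 2 (1 : Fin n → ℝ)‖ := by
      simp
    have h := (Matrix.toEuclideanCLM (𝕜 := ℝ) (circMatrix x)).le_opNorm (toLp 2 1)
    rw [row_sum, norm_smul, Real.norm_of_nonneg hs] at h
    exact le_of_mul_le_mul_right h ones_pos

theorem spectral_norm_circulant_fib (n : ℕ) (hn : 1 ≤ n) :
    ‖Matrix.toEuclideanCLM (𝕜 := ℝ)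
        (circMatrix (fun i : Fin n => (Nat.fib i : ℝ)))‖ =
      (Nat.fib (n + 1) : ℝ) - 1 := by
  have : NeZero n := ⟨by omega⟩
  rw [norm_toEuclideanCLM_circMatrix_of_nonneg fun i => Nat.cast_nonneg _,
    Fin.sum_univ_eq_sum_range fun i => (Nat.fib i : ℝ), Nat.fib_succ_eq_succ_sum]
  simp
end

section
/- Let n ≥ 1 and let A_P = circ(P₀, P₁, …, P_{n-1}) be the n×n circulant matrix whose entries are the first n Pell numbers. Then the spectral norm of A_P satisfies ‖A_P‖₂ = (P_n + P_{n-1} − 1)/2. -/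
/-- The Pell numbers: `P₀ = 0`, `P₁ = 1`, `Pₙ = 2Pₙ₋₁ + Pₙ₋₂`. -/
def pell : ℕ → ℕ
  | 0 => 0
  | 1 => 1
  | n + 2 => 2 * pell (n + 1) + pell n

theorem sum_pell_range (n : ℕ) :
    ∑ i ∈ Finset.range (n + 1), (pell i : ℝ) = ((pell (n + 1) : ℝ) + pell n - 1) / 2 := by
  induction n with
  | zero => simp [pell]
  | succ n ih =>
    rw [Finset.sum_range_succ, ih, show pell (n + 1 + 1) = 2 * pell (n + 1) + pell n from rfl]
    push_cast
    ring

/-- A nonnegative matrix all of whose row and column sums equal `S` has spectral norm `S`. -/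
theorem norm_toEuclideanCLM_of_row_col_sum {ι : Type*} [Fintype ι] [DecidableEq ι] [Nonempty ι]
    {A : Matrix ι ι ℝ} {S : ℝ} (hA : ∀ i j, 0 ≤ A i j) (hrow : ∀ i, ∑ j, A i j = S)
    (hcol : ∀ j, ∑ i, A i j = S) :
    ‖Matrix.toEuclideanCLM (𝕜 := ℝ) A‖ = S := by
  have hS : 0 ≤ S := by
    rw [← hrow (Classical.arbitrary ι)]
    exact Finset.sum_nonneg fun j _ => hA _ j
  apply le_antisymm
  · refine ContinuousLinearMap.opNorm_le_bound _ hS fun x => ?_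
    refine le_of_sq_le_sq ?_ (by positivity)
    rw [mul_pow, EuclideanSpace.real_norm_sq_eq, EuclideanSpace.real_norm_sq_eq]
    calc ∑ i, (Matrix.toEuclideanCLM (𝕜 := ℝ) A x) i ^ 2
        ≤ ∑ i, S * ∑ j, A i j * x j ^ 2 := by
          refine Finset.sum_le_sum fun i _ => ?_
          rw [Matrix.ofLp_toEuclideanCLM, ← hrow i]
          exact Finset.sum_sq_le_sum_mul_sum_of_sq_le_mul _ (fun j _ => hA i j)
            (fun j _ => mul_nonneg (hA i j) (sq_nonneg _)) fun j _ => by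
              apply le_of_eq; ring
      _ = S ^ 2 * ∑ j, x j ^ 2 := by
          rw [← Finset.mul_sum, Finset.sum_comm]
          simp_rw [← Finset.sum_mul, hcol]
          rw [← Finset.mul_sum]
          ring
  · set u : EuclideanSpace ℝ ι := WithLp.toLp 2 fun _ => 1 with hu
    have hAu : Matrix.toEuclideanCLM (𝕜 := ℝ) A u = S • u := by
      ext i
      simp [hu, Matrix.mulVec, dotProduct, hrow]
    have hu_pos : 0 < ‖u‖ := by
      refine norm_pos_iff.2 fun h => ?_
      have := congrArg (fun v : EuclideanSpace ℝ ι => v (Classical.arbitrary ι)) h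
      simp [hu] at this
    have := (Matrix.toEuclideanCLM (𝕜 := ℝ) A).le_opNorm u
    rw [hAu, norm_smul, Real.norm_of_nonneg hS] at this
    exact le_of_mul_le_mul_right this hu_pos

theorem spectral_norm_circulant_pell (n : ℕ) (hn : 1 ≤ n) :
    ‖Matrix.toEuclideanCLM (𝕜 := ℝ)
        (circMatrix (fun i : Fin n => (pell i : ℝ)))‖ =
      ((pell n : ℝ) + pell (n - 1) - 1) / 2 := by
  obtain ⟨m, rfl⟩ : ∃ m, n = m + 1 := ⟨n - 1, by omega⟩
  have hsum : ∑ k : Fin (m + 1), (pell k : ℝ) = ((pell (m + 1) : ℝ) + pell m - 1) / 2 := by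
    rw [← sum_pell_range, Finset.sum_range]
  refine norm_toEuclideanCLM_of_row_col_sum (fun i j => Nat.cast_nonneg _) (fun i => ?_)
    fun j => ?_
  · rw [Nat.add_sub_cancel, ← hsum]
    exact (Equiv.subRight i).sum_comp fun k : Fin (m + 1) => (pell k : ℝ)
  · rw [Nat.add_sub_cancel, ← hsum]
    exact (Equiv.subLeft j).sum_comp fun k : Fin (m + 1) => (pell k : ℝ)
end
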